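/- arXiv:1105.1497 — 12 statements merged into one kernel-verified Lean document; each statement's English description precedes it below -/
import Mathlib

section
/- Let X₁, X₂, X₃, X₄ be the smooth vector fields on ℝ³ (with coordinates (x,t,u)) given by X₁ = (0, 1, 0), X₂ = (x, t, x⁴/2), X₃ = (0, 0, u − x⁴/8), X₄ = (t·x, (t² − x²)/2, t·(7x⁴ + 8u)/16). Then their Lie brackets satisfy: [X₁,X₂] = X₁, [X₁,X₃] = 0, [X₁,X₄] = X₂ + (1/2)·X₃, [X₂,X₃] = 0, [X₂,X₄] = X₄, and [X₃,X₄] = 0. -/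
/-- The Lie bracket of two smooth vector fields on `ℝ³ = ℝ × ℝ × ℝ`,
defined pointwise by `[V,W](p) = (DW)(p)(V p) − (DV)(p)(W p)`. -/
noncomputable def lieBracketVF (V W : ℝ × ℝ × ℝ → ℝ × ℝ × ℝ) : ℝ × ℝ × ℝ → ℝ × ℝ × ℝ :=
  fun p => fderiv ℝ W p (V p) - fderiv ℝ V p (W p)

/-- `X₁ = ∂_t`. -/
noncomputable def X₁ : ℝ × ℝ × ℝ → ℝ × ℝ × ℝ := fun _ => (0, 1, 0)

/-- `X₂ = x ∂_x + t ∂_t + (x⁴/2) ∂_u`. -/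
noncomputable def X₂ : ℝ × ℝ × ℝ → ℝ × ℝ × ℝ := fun p => (p.1, p.2.1, p.1 ^ 4 / 2)

/-- `X₃ = (u − x⁴/8) ∂_u`. -/
noncomputable def X₃ : ℝ × ℝ × ℝ → ℝ × ℝ × ℝ := fun p => (0, 0, p.2.2 - p.1 ^ 4 / 8)

/-- `X₄ = tx ∂_x + ((t² − x²)/2) ∂_t + (t(7x⁴ + 8u)/16) ∂_u`. -/
noncomputable def X₄ : ℝ × ℝ × ℝ → ℝ × ℝ × ℝ :=
  fun p => (p.2.1 * p.1, (p.2.1 ^ 2 - p.1 ^ 2) / 2, p.2.1 * (7 * p.1 ^ 4 + 8 * p.2.2) / 16)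

/-- Derivative of `X₁`. -/
theorem fderiv_X₁ (p v : ℝ × ℝ × ℝ) : fderiv ℝ X₁ p v = (0, 0, 0) := by
  have h : HasFDerivAt X₁ (0 : ℝ × ℝ × ℝ →L[ℝ] ℝ × ℝ × ℝ) p := hasFDerivAt_const _ _
  rw [h.fderiv]; rfl

theorem hasFDerivAt_x (p : ℝ × ℝ × ℝ) :
    HasFDerivAt (fun q : ℝ × ℝ × ℝ => q.1) (ContinuousLinearMap.fst ℝ ℝ (ℝ × ℝ)) p :=
  hasFDerivAt_fst

theorem hasFDerivAt_t (p : ℝ × ℝ × ℝ) :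
    HasFDerivAt (fun q : ℝ × ℝ × ℝ => q.2.1)
      ((ContinuousLinearMap.fst ℝ ℝ ℝ).comp (ContinuousLinearMap.snd ℝ ℝ (ℝ × ℝ))) p :=
  ((ContinuousLinearMap.fst ℝ ℝ ℝ).comp (ContinuousLinearMap.snd ℝ ℝ (ℝ × ℝ))).hasFDerivAt

theorem hasFDerivAt_u (p : ℝ × ℝ × ℝ) :
    HasFDerivAt (fun q : ℝ × ℝ × ℝ => q.2.2)
      ((ContinuousLinearMap.snd ℝ ℝ ℝ).comp (ContinuousLinearMap.snd ℝ ℝ (ℝ × ℝ))) p :=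
  ((ContinuousLinearMap.snd ℝ ℝ ℝ).comp (ContinuousLinearMap.snd ℝ ℝ (ℝ × ℝ))).hasFDerivAt

theorem fderiv_X₂ (p v : ℝ × ℝ × ℝ) :
    fderiv ℝ X₂ p v = (v.1, v.2.1, 2 * p.1 ^ 3 * v.1) := by
  have h : HasFDerivAt X₂ _ p :=
    (hasFDerivAt_x p).prodMk ((hasFDerivAt_t p).prodMk (((hasFDerivAt_x p).pow 4).mul_const (2⁻¹ : ℝ)))
  rw [h.fderiv]
  ext <;> simp
  ring

theorem fderiv_X₃ (p v : ℝ × ℝ × ℝ) :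
    fderiv ℝ X₃ p v = (0, 0, v.2.2 - p.1 ^ 3 * v.1 / 2) := by
  have h : HasFDerivAt X₃ _ p :=
    (hasFDerivAt_const (0 : ℝ) p).prodMk ((hasFDerivAt_const (0 : ℝ) p).prodMk
      ((hasFDerivAt_u p).sub (((hasFDerivAt_x p).pow 4).mul_const (8⁻¹ : ℝ))))
  rw [h.fderiv]
  ext <;> simp
  ring

theorem fderiv_X₄ (p v : ℝ × ℝ × ℝ) :
    fderiv ℝ X₄ p v = (p.2.1 * v.1 + p.1 * v.2.1, p.2.1 * v.2.1 - p.1 * v.1,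
      (v.2.1 * (7 * p.1 ^ 4 + 8 * p.2.2) + p.2.1 * (28 * p.1 ^ 3 * v.1 + 8 * v.2.2)) / 16) := by
  have h : HasFDerivAt X₄ _ p :=
    ((hasFDerivAt_t p).mul (hasFDerivAt_x p)).prodMk
      (((((hasFDerivAt_t p).pow 2).sub ((hasFDerivAt_x p).pow 2)).mul_const (2⁻¹ : ℝ)).prodMk
      (((hasFDerivAt_t p).mul ((((hasFDerivAt_x p).pow 4).const_mul 7).add
        ((hasFDerivAt_u p).const_mul 8))).mul_const (16⁻¹ : ℝ)))
  rw [h.fderiv]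
  ext <;> simp <;> ring

/-- The commutation relations of the symmetry generators of the Grad–Shafranov
equation `u_xx − (1/x) u_x + u_tt = x²`:
`[X₁,X₂] = X₁`, `[X₁,X₃] = 0`, `[X₁,X₄] = X₂ + (1/2) X₃`,
`[X₂,X₃] = 0`, `[X₂,X₄] = X₄`, `[X₃,X₄] = 0`. -/
theorem grad_shafranov_commutation_relations :
    lieBracketVF X₁ X₂ = X₁ ∧
    lieBracketVF X₁ X₃ = 0 ∧
    lieBracketVF X₁ X₄ = (fun p => X₂ p + (1 / 2 : ℝ) • X₃ p) ∧
    lieBracketVF X₂ X₃ = 0 ∧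
    lieBracketVF X₂ X₄ = X₄ ∧
    lieBracketVF X₃ X₄ = 0 := by
  refine ⟨?_, ?_, ?_, ?_, ?_, ?_⟩ <;> funext p <;>
    simp only [lieBracketVF, fderiv_X₁, fderiv_X₂, fderiv_X₃, fderiv_X₄] <;>
    ext <;> simp [X₁, X₂, X₃, X₄] <;> ring
end

section
/- Let Ω ⊆ {(x,t) ∈ ℝ² : x ≠ 0} be open and let u : ℝ² → ℝ be C² on Ω and satisfy u_xx − (1/x)·u_x + u_tt = x² on Ω. Then for every s ∈ ℝ, the function v(x,t) = u(e^{−s}·x, e^{−s}·t) + (x⁴/8)·(1 − e^{−4s}) satisfies v_xx − (1/x)·v_x + v_tt = x² at every point (x,t) with x ≠ 0 and (e^{−s}x, e^{−s}t) ∈ Ω. -/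
/-- Partial derivative in the first (spatial) variable `x`. -/
noncomputable def px (u : ℝ × ℝ → ℝ) (p : ℝ × ℝ) : ℝ := fderiv ℝ u p (1, 0)

/-- Partial derivative in the second (temporal) variable `t`. -/
noncomputable def pt (u : ℝ × ℝ → ℝ) (p : ℝ × ℝ) : ℝ := fderiv ℝ u p (0, 1)

/-- The Grad–Shafranov operator `u ↦ u_xx − (1/x) u_x + u_tt`. -/
noncomputable def GS (u : ℝ × ℝ → ℝ) (p : ℝ × ℝ) : ℝ :=
  px (px u) p - (1 / p.1) * px u p + pt (pt u) p

theorem gs_aux (f : ℝ × ℝ → ℝ) (a c k : ℝ) (n : ℕ) (p : ℝ × ℝ)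
    (hf : DifferentiableAt ℝ f (c * p.1, c * p.2)) :
    px (fun q => a * f (c * q.1, c * q.2) + k * q.1 ^ n) p
      = a * c * px f (c * p.1, c * p.2) + k * (n * p.1 ^ (n - 1)) ∧
    pt (fun q => a * f (c * q.1, c * q.2) + k * q.1 ^ n) p
      = a * c * pt f (c * p.1, c * p.2) := by
  have h1 : HasFDerivAt (fun q : ℝ × ℝ => (c * q.1, c * q.2))
      ((c • ContinuousLinearMap.fst ℝ ℝ ℝ).prod (c • ContinuousLinearMap.snd ℝ ℝ ℝ)) p :=
    (hasFDerivAt_fst.const_mul c).prodMk (hasFDerivAt_snd.const_mul c)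
  have h2 := HasFDerivAt.comp (f := fun q : ℝ × ℝ => (c * q.1, c * q.2)) p hf.hasFDerivAt h1
  have h3 : HasFDerivAt (fun q : ℝ × ℝ => q.1 ^ n)
      ((n * p.1 ^ (n - 1)) • ContinuousLinearMap.fst ℝ ℝ ℝ) p :=
    (hasDerivAt_pow n p.1).comp_hasFDerivAt p hasFDerivAt_fst
  have h4 : HasFDerivAt (fun q : ℝ × ℝ => a * f (c * q.1, c * q.2) + k * q.1 ^ n) _ p :=
    (h2.const_mul a).add (h3.const_mul k)
  have e1 : ((c, 0) : ℝ × ℝ) = c • (1, 0) := by simp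
  have e2 : ((0, c) : ℝ × ℝ) = c • (0, 1) := by simp
  unfold px pt
  rw [h4.fderiv]
  constructor
  · simp [e1, mul_assoc, -Prod.smul_mk]
  · simp [e2, mul_assoc, -Prod.smul_mk]

/-- The scaling symmetry generated by `X₂ = x ∂_x + t ∂_t + (x⁴/2) ∂_u` maps solutions
of the Grad–Shafranov equation `u_xx − (1/x) u_x + u_tt = x²` to solutions:
if `u` solves the equation on `Ω`, then for every `s ∈ ℝ` the function
`v(x,t) = u(e^{−s} x, e^{−s} t) + (x⁴/8)(1 − e^{−4s})` also solves it. -/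
theorem grad_shafranov_scaling_symmetry
    (Ω : Set (ℝ × ℝ)) (hΩ : IsOpen Ω) (hΩx : Ω ⊆ {p : ℝ × ℝ | p.1 ≠ 0})
    (u : ℝ × ℝ → ℝ) (hu : ContDiffOn ℝ 2 u Ω)
    (hsol : ∀ p ∈ Ω, GS u p = p.1 ^ 2) (s : ℝ) :
    ∀ p : ℝ × ℝ, p.1 ≠ 0 → (Real.exp (-s) * p.1, Real.exp (-s) * p.2) ∈ Ω →
      GS (fun q => u (Real.exp (-s) * q.1, Real.exp (-s) * q.2) +
        q.1 ^ 4 / 8 * (1 - Real.exp (-4 * s))) p = p.1 ^ 2 := by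
  intro p hp hpΩ
  set c := Real.exp (-s) with hc
  have hc0 : c ≠ 0 := (Real.exp_pos _).ne'
  have hc4 : Real.exp (-4 * s) = c ^ 4 := by
    rw [hc, ← Real.exp_nat_mul]; congr 1; push_cast; ring
  rw [hc4]
  have hd : ∀ q ∈ Ω, DifferentiableAt ℝ u q := fun q hq =>
    (hu.contDiffAt (hΩ.mem_nhds hq)).differentiableAt (by norm_num)
  have hd2 : ∀ q ∈ Ω, DifferentiableAt ℝ (fderiv ℝ u) q := fun q hq =>
    ((hu.contDiffAt (hΩ.mem_nhds hq)).fderiv_right (m := 1) (by norm_num)).differentiableAt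
      (by norm_num)
  have hdx : ∀ q ∈ Ω, DifferentiableAt ℝ (px u) q := fun q hq =>
    (hd2 q hq).clm_apply (differentiableAt_const _)
  have hdt : ∀ q ∈ Ω, DifferentiableAt ℝ (pt u) q := fun q hq =>
    (hd2 q hq).clm_apply (differentiableAt_const _)
  set v : ℝ × ℝ → ℝ := fun q => u (c * q.1, c * q.2) + q.1 ^ 4 / 8 * (1 - c ^ 4) with hv
  have hv' : v = fun q => 1 * u (c * q.1, c * q.2) + ((1 - c ^ 4) / 8) * q.1 ^ 4 := by
    funext q; simp only [hv]; ring
  have hev : ∀ᶠ q : ℝ × ℝ in nhds p, (c * q.1, c * q.2) ∈ Ω := by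
    have hcont : Continuous (fun q : ℝ × ℝ => (c * q.1, c * q.2)) := by fun_prop
    exact hcont.continuousAt.eventually (hΩ.mem_nhds hpΩ)
  have hx : px v =ᶠ[nhds p]
      fun q => c * px u (c * q.1, c * q.2) + ((1 - c ^ 4) / 2) * q.1 ^ 3 := by
    filter_upwards [hev] with q hq
    rw [hv', (gs_aux u 1 c _ 4 q (hd _ hq)).1]
    push_cast; ring
  have ht : pt v =ᶠ[nhds p]
      fun q => c * pt u (c * q.1, c * q.2) + 0 * q.1 ^ 0 := by
    filter_upwards [hev] with q hq
    rw [hv', (gs_aux u 1 c _ 4 q (hd _ hq)).2]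
    ring
  have hxx : px (px v) p = c * c * px (px u) (c * p.1, c * p.2)
      + ((1 - c ^ 4) / 2) * (3 * p.1 ^ 2) := by
    have := (gs_aux (px u) c c ((1 - c ^ 4) / 2) 3 p (hdx _ hpΩ)).1
    rw [px, hx.fderiv_eq]
    simpa [px] using this
  have htt : pt (pt v) p = c * c * pt (pt u) (c * p.1, c * p.2) := by
    have := (gs_aux (pt u) c c 0 0 p (hdt _ hpΩ)).2
    rw [pt, ht.fderiv_eq]
    exact this
  have h := hsol _ hpΩ
  unfold GS at h ⊢
  rw [hxx, htt, hx.eq_of_nhds]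
  simp only at h ⊢
  have h' : c * c * px (px u) (c * p.1, c * p.2) - c / p.1 * px u (c * p.1, c * p.2)
      + c * c * pt (pt u) (c * p.1, c * p.2) = c ^ 4 * p.1 ^ 2 := by
    have : c / p.1 = c * c * (1 / (c * p.1)) := by field_simp
    rw [this]
    linear_combination c * c * h
  have h5 : 1 / p.1 * p.1 ^ 3 = p.1 ^ 2 := by field_simp
  linear_combination h' - (1 - c ^ 4) / 2 * h5
end

section
/- Let Ω ⊆ {(x,t) ∈ ℝ² : x ≠ 0} be open and let u : ℝ² → ℝ be C³ on Ω and satisfy u_xx − (1/x)·u_x + u_tt = x² on Ω. Define Q : Ω → ℝ by Q(x,t) = (1/16)·t·(7x⁴ + 8·u(x,t)) − t·x·u_x(x,t) − (1/2)·(t² − x²)·u_t(x,t). Then Q satisfies the homogeneous equation Q_xx − (1/x)·Q_x + Q_tt = 0 on Ω. -/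
/-- `f` has partial derivatives `a`, `b` at `p` (Fréchet sense). -/
def HasP (f : ℝ × ℝ → ℝ) (a b : ℝ) (p : ℝ × ℝ) : Prop :=
  DifferentiableAt ℝ f p ∧ px f p = a ∧ pt f p = b

theorem HasP.of_diff {f : ℝ × ℝ → ℝ} {p : ℝ × ℝ} (h : DifferentiableAt ℝ f p) :
    HasP f (px f p) (pt f p) p := ⟨h, rfl, rfl⟩

theorem HasP.add {f g : ℝ × ℝ → ℝ} {a b c d : ℝ} {p : ℝ × ℝ} (hf : HasP f a b p)
    (hg : HasP g c d p) : HasP (fun q => f q + g q) (a + c) (b + d) p := by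
  obtain ⟨h, rfl, rfl⟩ := hf
  obtain ⟨h', rfl, rfl⟩ := hg
  refine ⟨h.add h', ?_, ?_⟩ <;> simp [px, pt, fderiv_fun_add h h']

theorem HasP.sub {f g : ℝ × ℝ → ℝ} {a b c d : ℝ} {p : ℝ × ℝ} (hf : HasP f a b p)
    (hg : HasP g c d p) : HasP (fun q => f q - g q) (a - c) (b - d) p := by
  obtain ⟨h, rfl, rfl⟩ := hf
  obtain ⟨h', rfl, rfl⟩ := hg
  refine ⟨h.sub h', ?_, ?_⟩ <;> simp [px, pt, fderiv_fun_sub h h']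

theorem HasP.mul {f g : ℝ × ℝ → ℝ} {a b c d : ℝ} {p : ℝ × ℝ} (hf : HasP f a b p)
    (hg : HasP g c d p) :
    HasP (fun q => f q * g q) (f p * c + g p * a) (f p * d + g p * b) p := by
  obtain ⟨h, rfl, rfl⟩ := hf
  obtain ⟨h', rfl, rfl⟩ := hg
  refine ⟨h.mul h', ?_, ?_⟩ <;> simp [px, pt, fderiv_fun_mul h h']

theorem HasP.const (c : ℝ) (p : ℝ × ℝ) : HasP (fun _ => c) 0 0 p := by
  refine ⟨differentiableAt_const c, ?_, ?_⟩ <;> simp [px, pt]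

theorem HasP.fst (p : ℝ × ℝ) : HasP (fun q => q.1) 1 0 p := by
  refine ⟨differentiableAt_fst, ?_, ?_⟩ <;> simp [px, pt, fderiv_fst]

theorem HasP.snd (p : ℝ × ℝ) : HasP (fun q => q.2) 0 1 p := by
  refine ⟨differentiableAt_snd, ?_, ?_⟩ <;> simp [px, pt, fderiv_snd]

theorem HasP.pow {f : ℝ × ℝ → ℝ} {a b : ℝ} {p : ℝ × ℝ} (hf : HasP f a b p) (n : ℕ) :
    HasP (fun q => f q ^ n) (n * f p ^ (n - 1) * a) (n * f p ^ (n - 1) * b) p := by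
  obtain ⟨h, rfl, rfl⟩ := hf
  refine ⟨h.pow n, ?_, ?_⟩ <;> simp [px, pt, fderiv_fun_pow n h]

theorem px_congr {f g : ℝ × ℝ → ℝ} {Ω : Set (ℝ × ℝ)} (hΩ : IsOpen Ω)
    (h : ∀ q ∈ Ω, f q = g q) {p : ℝ × ℝ} (hp : p ∈ Ω) : px f p = px g p := by
  have : f =ᶠ[nhds p] g := Filter.eventually_of_mem (hΩ.mem_nhds hp) h
  simp [px, this.fderiv_eq]

theorem pt_congr {f g : ℝ × ℝ → ℝ} {Ω : Set (ℝ × ℝ)} (hΩ : IsOpen Ω)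
    (h : ∀ q ∈ Ω, f q = g q) {p : ℝ × ℝ} (hp : p ∈ Ω) : pt f p = pt g p := by
  have : f =ᶠ[nhds p] g := Filter.eventually_of_mem (hΩ.mem_nhds hp) h
  simp [pt, this.fderiv_eq]

theorem contDiffOn_px {f : ℝ × ℝ → ℝ} {Ω : Set (ℝ × ℝ)} (hΩ : IsOpen Ω) {m n : WithTop ℕ∞}
    (h : ContDiffOn ℝ n f Ω) (hmn : m + 1 ≤ n) : ContDiffOn ℝ m (px f) Ω :=
  (h.fderiv_of_isOpen hΩ hmn).clm_apply contDiffOn_const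

theorem contDiffOn_pt {f : ℝ × ℝ → ℝ} {Ω : Set (ℝ × ℝ)} (hΩ : IsOpen Ω) {m n : WithTop ℕ∞}
    (h : ContDiffOn ℝ n f Ω) (hmn : m + 1 ≤ n) : ContDiffOn ℝ m (pt f) Ω :=
  (h.fderiv_of_isOpen hΩ hmn).clm_apply contDiffOn_const

theorem px_pt_comm {f : ℝ × ℝ → ℝ} {Ω : Set (ℝ × ℝ)} (hΩ : IsOpen Ω)
    (h : ContDiffOn ℝ 2 f Ω) {p : ℝ × ℝ} (hp : p ∈ Ω) : px (pt f) p = pt (px f) p := by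
  have hc : ContDiffAt ℝ 2 f p := h.contDiffAt (hΩ.mem_nhds hp)
  have hs := hc.isSymmSndFDerivAt (by simp)
  have hd : DifferentiableAt ℝ (fderiv ℝ f) p :=
    (hc.fderiv_right (m := 1) (by norm_num)).differentiableAt (by norm_num)
  have e1 : px (pt f) p = fderiv ℝ (fderiv ℝ f) p (1, 0) (0, 1) := by
    unfold px pt
    rw [fderiv_clm_apply hd (differentiableAt_const _)]
    simp
  have e2 : pt (px f) p = fderiv ℝ (fderiv ℝ f) p (0, 1) (1, 0) := by
    unfold px pt
    rw [fderiv_clm_apply hd (differentiableAt_const _)]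
    simp
  rw [e1, e2]
  exact hs _ _

/-- The characteristic `Q = φ − ξ¹ u_x − ξ² u_t` of the symmetry generator
`X₄ = tx ∂_x + (1/2)(t² − x²) ∂_t + (1/16) t (7x⁴ + 8u) ∂_u` of the Grad–Shafranov
equation: if `u` solves `u_xx − (1/x) u_x + u_tt = x²` on `Ω`, then
`Q(x,t) = (1/16) t (7x⁴ + 8u) − tx·u_x − (1/2)(t² − x²)·u_t` solves the
homogeneous equation `Q_xx − (1/x) Q_x + Q_tt = 0` on `Ω`. -/
theorem grad_shafranov_X4_characteristic
    (Ω : Set (ℝ × ℝ)) (hΩ : IsOpen Ω) (hΩx : Ω ⊆ {p : ℝ × ℝ | p.1 ≠ 0})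
    (u : ℝ × ℝ → ℝ) (hu : ContDiffOn ℝ 3 u Ω)
    (hsol : ∀ p ∈ Ω, GS u p = p.1 ^ 2) :
    ∀ p ∈ Ω,
      GS (fun q => (1 / 16) * q.2 * (7 * q.1 ^ 4 + 8 * u q) - q.2 * q.1 * px u q
        - (1 / 2) * (q.2 ^ 2 - q.1 ^ 2) * pt u q) p = 0 := by
  have h1 : ∀ {f : ℝ × ℝ → ℝ} {n : WithTop ℕ∞}, ContDiffOn ℝ n f Ω → n ≠ 0 → ∀ q ∈ Ω,
      HasP f (px f q) (pt f q) q := fun h hn q hq =>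
    HasP.of_diff ((h.contDiffAt (hΩ.mem_nhds hq)).differentiableAt hn)
  have cx : ContDiffOn ℝ 2 (px u) Ω := contDiffOn_px hΩ hu (by norm_num)
  have ct : ContDiffOn ℝ 2 (pt u) Ω := contDiffOn_pt hΩ hu (by norm_num)
  have cxx : ContDiffOn ℝ 1 (px (px u)) Ω := contDiffOn_px hΩ cx (by norm_num)
  have cxt : ContDiffOn ℝ 1 (pt (px u)) Ω := contDiffOn_pt hΩ cx (by norm_num)
  have ctt : ContDiffOn ℝ 1 (pt (pt u)) Ω := contDiffOn_pt hΩ ct (by norm_num)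
  have hu2 : ContDiffOn ℝ 2 u Ω := hu.of_le (by norm_num)
  have comm : ∀ q ∈ Ω, px (pt u) q = pt (px u) q := fun q hq => px_pt_comm hΩ hu2 hq
  have Du := h1 hu (by norm_num)
  have Dx := h1 cx (by norm_num)
  have Dt := h1 ct (by norm_num)
  have Dxx := h1 cxx (by norm_num)
  have Dxt := h1 cxt (by norm_num)
  have Dtt := h1 ctt (by norm_num)
  -- first derivatives of `Q`
  have HQ : ∀ q ∈ Ω, HasP (fun q => (1 / 16) * q.2 * (7 * q.1 ^ 4 + 8 * u q)
      - q.2 * q.1 * px u q - (1 / 2) * (q.2 ^ 2 - q.1 ^ 2) * pt u q) _ _ q := fun q hq =>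
    (((((HasP.const (1 / 16) q).mul (HasP.snd q)).mul
      (((HasP.const 7 q).mul ((HasP.fst q).pow 4)).add ((HasP.const 8 q).mul (Du q hq)))).sub
      (((HasP.snd q).mul (HasP.fst q)).mul (Dx q hq))).sub
      (((HasP.const (1 / 2) q).mul (((HasP.snd q).pow 2).sub ((HasP.fst q).pow 2))).mul (Dt q hq)))
  have Qx : ∀ q ∈ Ω, px (fun q => (1 / 16) * q.2 * (7 * q.1 ^ 4 + 8 * u q)
      - q.2 * q.1 * px u q - (1 / 2) * (q.2 ^ 2 - q.1 ^ 2) * pt u q) q =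
      (7 / 4) * q.2 * q.1 ^ 3 - (1 / 2) * q.2 * px u q - q.2 * q.1 * px (px u) q
        + q.1 * pt u q - (1 / 2) * (q.2 ^ 2 - q.1 ^ 2) * pt (px u) q := by
    intro q hq
    rw [(HQ q hq).2.1, comm q hq]
    push_cast
    ring
  have Qt : ∀ q ∈ Ω, pt (fun q => (1 / 16) * q.2 * (7 * q.1 ^ 4 + 8 * u q)
      - q.2 * q.1 * px u q - (1 / 2) * (q.2 ^ 2 - q.1 ^ 2) * pt u q) q =
      (7 / 16) * q.1 ^ 4 + (1 / 2) * u q - (1 / 2) * q.2 * pt u q - q.1 * px u q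
        - q.2 * q.1 * pt (px u) q - (1 / 2) * (q.2 ^ 2 - q.1 ^ 2) * pt (pt u) q := by
    intro q hq
    rw [(HQ q hq).2.2]
    push_cast
    ring
  intro p hp
  have hx : p.1 ≠ 0 := hΩx hp
  -- second derivatives of `Q`
  have Hx := ((((((HasP.const (7 / 4) p).mul (HasP.snd p)).mul ((HasP.fst p).pow 3)).sub
    (((HasP.const (1 / 2) p).mul (HasP.snd p)).mul (Dx p hp))).sub
    (((HasP.snd p).mul (HasP.fst p)).mul (Dxx p hp))).add
    ((HasP.fst p).mul (Dt p hp))).sub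
    (((HasP.const (1 / 2) p).mul (((HasP.snd p).pow 2).sub ((HasP.fst p).pow 2))).mul (Dxt p hp))
  have Ht := (((((((HasP.const (7 / 16) p).mul ((HasP.fst p).pow 4)).add
    ((HasP.const (1 / 2) p).mul (Du p hp))).sub
    (((HasP.const (1 / 2) p).mul (HasP.snd p)).mul (Dt p hp))).sub
    ((HasP.fst p).mul (Dx p hp))).sub
    (((HasP.snd p).mul (HasP.fst p)).mul (Dxt p hp))).sub
    (((HasP.const (1 / 2) p).mul (((HasP.snd p).pow 2).sub ((HasP.fst p).pow 2))).mul (Dtt p hp)))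
  -- derivatives of the equation, multiplied by `x`
  have eqn : ∀ q ∈ Ω, q.1 * px (px u) q - px u q + q.1 * pt (pt u) q = q.1 ^ 3 := by
    intro q hq
    have h := hsol q hq
    have hq0 : q.1 ≠ 0 := hΩx hq
    unfold GS at h
    field_simp at h
    linarith
  have E := (((HasP.fst p).mul (Dxx p hp)).sub (Dx p hp)).add ((HasP.fst p).mul (Dtt p hp))
  have C := (HasP.fst p).pow 3
  have Ex := (E.2.1.symm.trans (px_congr hΩ eqn hp)).trans C.2.1
  have Et := (E.2.2.symm.trans (pt_congr hΩ eqn hp)).trans C.2.2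
  have c1 : px (pt (px u)) p = pt (px (px u)) p := px_pt_comm hΩ cx hp
  have c2 : px (pt (pt u)) p = pt (pt (px u)) p :=
    (px_pt_comm hΩ ct hp).trans (pt_congr hΩ comm hp)
  have E0 := eqn p hp
  unfold GS
  rw [px_congr hΩ Qx hp, pt_congr hΩ Qt hp, Hx.2.1, Ht.2.2, Qx p hp]
  rw [c2] at Ex
  rw [c1, comm p hp]
  push_cast at Ex Et ⊢
  generalize px (px (px u)) p = uxxx at *
  generalize pt (px (px u)) p = uxxt at *
  generalize pt (pt (px u)) p = uxtt at *
  generalize pt (pt (pt u)) p = uttt at *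
  generalize px (px u) p = uxx at *
  generalize pt (px u) p = uxt at *
  generalize pt (pt u) p = utt at *
  generalize px u p = ux at *
  generalize pt u p = ut at *
  generalize p.1 = x at *
  generalize p.2 = t at *
  norm_num at Ex Et
  push_cast
  field_simp
  ring_nf
  ring_nf at Ex Et E0
  linear_combination 128 * ((-t * x) * Ex - (t ^ 2 - x ^ 2) / 2 * Et - t / 2 * E0)
end

section
/- Let Ω ⊆ {(x,t) ∈ ℝ² : x ≠ 0} be open and let u : ℝ² → ℝ be C³ on Ω and satisfy u_xx − (1/x)·u_x + u_tt = x² on Ω. Define Q : Ω → ℝ by Q(x,t) = x⁴/2 − x·u_x(x,t) − t·u_t(x,t). Then Q satisfies the homogeneous equation Q_xx − (1/x)·Q_x + Q_tt = 0 on Ω. -/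
lemma gs_congr {Ω : Set (ℝ × ℝ)} (hΩ : IsOpen Ω) {f g : ℝ × ℝ → ℝ}
    (h : ∀ p ∈ Ω, f p = g p) {p : ℝ × ℝ} (hp : p ∈ Ω) : fderiv ℝ f p = fderiv ℝ g p := by
  apply Filter.EventuallyEq.fderiv_eq
  filter_upwards [hΩ.mem_nhds hp] with q hq using h q hq

lemma gs_contDiff {Ω : Set (ℝ × ℝ)} (hΩ : IsOpen Ω) {f : ℝ × ℝ → ℝ} {m n : WithTop ℕ∞}
    (hf : ContDiffOn ℝ n f Ω) (hmn : m + 1 ≤ n) (v : ℝ × ℝ) :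
    ContDiffOn ℝ m (fun p => fderiv ℝ f p v) Ω :=
  (hf.fderiv_of_isOpen hΩ hmn).clm_apply contDiffOn_const

lemma gs_symm {Ω : Set (ℝ × ℝ)} (hΩ : IsOpen Ω) {f : ℝ × ℝ → ℝ}
    (hf : ContDiffOn ℝ 2 f Ω) {p : ℝ × ℝ} (hp : p ∈ Ω) : px (pt f) p = pt (px f) p := by
  have hc : ContDiffAt ℝ 2 f p := hf.contDiffAt (hΩ.mem_nhds hp)
  have hs : IsSymmSndFDerivAt ℝ f p := hc.isSymmSndFDerivAt (by simp)
  have hd : DifferentiableAt ℝ (fderiv ℝ f) p :=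
    (hc.fderiv_right (m := 1) (by norm_num)).differentiableAt (by simp)
  have key : ∀ v w : ℝ × ℝ, fderiv ℝ (fun q => fderiv ℝ f q v) p w
      = fderiv ℝ (fderiv ℝ f) p w v := by
    intro v w
    rw [fderiv_clm_apply hd (by fun_prop)]
    simp
  change fderiv ℝ (fun q => fderiv ℝ f q (0, 1)) p (1, 0)
    = fderiv ℝ (fun q => fderiv ℝ f q (1, 0)) p (0, 1)
  rw [key, key]
  exact hs.eq _ _

lemma gs_form {f g h : ℝ × ℝ → ℝ} {p : ℝ × ℝ} (hf : DifferentiableAt ℝ f p)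
    (hg : DifferentiableAt ℝ g p) (hh : DifferentiableAt ℝ h p) (v : ℝ × ℝ) :
    fderiv ℝ (fun q => h q - q.1 * f q - q.2 * g q) p v
      = fderiv ℝ h p v - (v.1 * f p + p.1 * fderiv ℝ f p v)
        - (v.2 * g p + p.2 * fderiv ℝ g p v) := by
  have h1 := (hasFDerivAt_fst (𝕜 := ℝ) (p := p)).mul hf.hasFDerivAt
  have h2 := (hasFDerivAt_snd (𝕜 := ℝ) (p := p)).mul hg.hasFDerivAt
  have h3 : HasFDerivAt (fun q : ℝ × ℝ => h q - q.1 * f q - q.2 * g q) _ p :=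
    (hh.hasFDerivAt.sub h1).sub h2
  rw [h3.fderiv]
  simp
  ring

lemma gs_pow (c : ℝ) (n : ℕ) (k : ℝ × ℝ → ℝ) (p v : ℝ × ℝ) (hk : DifferentiableAt ℝ k p) :
    fderiv ℝ (fun q : ℝ × ℝ => c * q.1 ^ n + k q) p v
      = c * (n * p.1 ^ (n - 1) * v.1) + fderiv ℝ k p v := by
  have h1 := (((hasFDerivAt_fst (𝕜 := ℝ) (p := p)).pow n).const_mul c)
  have h3 : HasFDerivAt (fun q : ℝ × ℝ => c * q.1 ^ n + k q) _ p := h1.add hk.hasFDerivAt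
  rw [h3.fderiv]
  simp

/-- The characteristic `Q = φ − ξ¹ u_x − ξ² u_t` of the symmetry generator
`X₂ = x ∂_x + t ∂_t + (x⁴/2) ∂_u` of the Grad–Shafranov equation: if `u` solves
`u_xx − (1/x) u_x + u_tt = x²` on `Ω`, then `Q(x,t) = x⁴/2 − x·u_x − t·u_t`
solves the homogeneous equation `Q_xx − (1/x) Q_x + Q_tt = 0` on `Ω`. -/
theorem grad_shafranov_X2_characteristic
    (Ω : Set (ℝ × ℝ)) (hΩ : IsOpen Ω) (hΩx : Ω ⊆ {p : ℝ × ℝ | p.1 ≠ 0})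
    (u : ℝ × ℝ → ℝ) (hu : ContDiffOn ℝ 3 u Ω)
    (hsol : ∀ p ∈ Ω, GS u p = p.1 ^ 2) :
    ∀ p ∈ Ω,
      GS (fun q => q.1 ^ 4 / 2 - q.1 * px u q - q.2 * pt u q) p = 0 := by
  have dat : ∀ {f : ℝ × ℝ → ℝ}, ContDiffOn ℝ 1 f Ω → ∀ q ∈ Ω, DifferentiableAt ℝ f q :=
    fun hf q hq => (hf.contDiffAt (hΩ.mem_nhds hq)).differentiableAt (by simp)
  have ca : ContDiffOn ℝ 2 (px u) Ω := gs_contDiff hΩ hu (by norm_num) _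
  have cb : ContDiffOn ℝ 2 (pt u) Ω := gs_contDiff hΩ hu (by norm_num) _
  have cax : ContDiffOn ℝ 1 (px (px u)) Ω := gs_contDiff hΩ ca (by norm_num) _
  have cat : ContDiffOn ℝ 1 (pt (px u)) Ω := gs_contDiff hΩ ca (by norm_num) _
  have cbx : ContDiffOn ℝ 1 (px (pt u)) Ω := gs_contDiff hΩ cb (by norm_num) _
  have cbt : ContDiffOn ℝ 1 (pt (pt u)) Ω := gs_contDiff hΩ cb (by norm_num) _
  have da := dat (ca.of_le (by norm_num))
  have db := dat (cb.of_le (by norm_num))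
  have dax := dat cax
  have dat' := dat cat
  have dbx := dat cbx
  have dbt := dat cbt
  have sy : ∀ q ∈ Ω, px (pt u) q = pt (px u) q :=
    fun q hq => gs_symm hΩ (hu.of_le (by norm_num)) hq
  have dpow : ∀ (c : ℝ) (n : ℕ) (k : ℝ × ℝ → ℝ) (q : ℝ × ℝ), DifferentiableAt ℝ k q →
      DifferentiableAt ℝ (fun q : ℝ × ℝ => c * q.1 ^ n + k q) q := by
    intro c n k q hk
    fun_prop
  have hQ : (fun q : ℝ × ℝ => q.1 ^ 4 / 2 - q.1 * px u q - q.2 * pt u q)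
      = fun q => (1 / 2 * q.1 ^ 4 + (fun _ => (0 : ℝ)) q) - q.1 * px u q - q.2 * pt u q := by
    funext q
    ring
  have d0 : ∀ q : ℝ × ℝ, DifferentiableAt ℝ (fun _ : ℝ × ℝ => (0 : ℝ)) q := by
    intro q
    fun_prop
  rw [hQ]
  set Q : ℝ × ℝ → ℝ :=
    fun q => (1 / 2 * q.1 ^ 4 + (fun _ => (0 : ℝ)) q) - q.1 * px u q - q.2 * pt u q with hQdef
  have Qx : ∀ q ∈ Ω, px Q q
      = (2 * q.1 ^ 3 + (fun r => - px u r) q) - q.1 * px (px u) q - q.2 * px (pt u) q := by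
    intro q hq
    have := gs_form (da q hq) (db q hq) (dpow (1 / 2) 4 _ q (d0 q)) (1, 0)
    rw [gs_pow _ _ _ _ _ (d0 q)] at this
    simp only [px, hQdef] at this ⊢
    rw [this]
    simp
    ring
  have Qt : ∀ q ∈ Ω, pt Q q
      = (0 * q.1 ^ 3 + (fun r => - pt u r) q) - q.1 * pt (px u) q - q.2 * pt (pt u) q := by
    intro q hq
    have := gs_form (da q hq) (db q hq) (dpow (1 / 2) 4 _ q (d0 q)) (0, 1)
    rw [gs_pow _ _ _ _ _ (d0 q)] at this
    simp only [pt, hQdef] at this ⊢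
    rw [this]
    simp
    ring
  intro p hp
  have hx : p.1 ≠ 0 := hΩx hp
  have Qxx : px (px Q) p = 6 * p.1 ^ 2 - 2 * px (px u) p - p.1 * px (px (px u)) p
      - p.2 * px (px (pt u)) p := by
    have := gs_form (dax p hp) (dbx p hp) (dpow 2 3 _ p (da p hp).neg) (1, 0)
    rw [gs_pow _ _ _ _ _ (da p hp).neg, fderiv_neg] at this
    have e : px (px Q) p = _ := congrArg (fun L => L (1, 0)) (gs_congr hΩ Qx hp)
    rw [e]
    refine this.trans ?_
    simp [px]
    ring
  have Qtt : pt (pt Q) p = - 2 * pt (pt u) p - p.1 * pt (pt (px u)) p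
      - p.2 * pt (pt (pt u)) p := by
    have := gs_form (dat' p hp) (dbt p hp) (dpow 0 3 _ p (db p hp).neg) (0, 1)
    rw [gs_pow _ _ _ _ _ (db p hp).neg, fderiv_neg] at this
    have e : pt (pt Q) p = _ := congrArg (fun L => L (0, 1)) (gs_congr hΩ Qt hp)
    rw [e]
    refine this.trans ?_
    simp [pt]
    ring
  have E : ∀ q ∈ Ω, (1 * q.1 ^ 3 + px u q) - q.1 * (px (px u) q + pt (pt u) q)
      - q.2 * (fun _ => (0 : ℝ)) q = (fun _ => (0 : ℝ)) q := by
    intro q hq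
    have hq0 : q.1 ≠ 0 := hΩx hq
    have := hsol q hq
    unfold GS at this
    field_simp at this
    simp only
    linear_combination -this
  have E' : ∀ v, _ := fun v => (gs_form ((dax p hp).add (dbt p hp)) (d0 p)
    (dpow 1 3 _ p (da p hp)) v).symm.trans (congrArg (fun L => L v) (gs_congr hΩ E hp))
  have Ex := E' (1, 0)
  have Et := E' (0, 1)
  rw [gs_pow _ _ _ _ _ (da p hp), fderiv_add (dax p hp) (dbt p hp)] at Ex Et
  have s1 : px (pt (pt u)) p = pt (pt (px u)) p :=
    (gs_symm hΩ cb hp).trans (congrArg (fun L => L (0, 1)) (gs_congr hΩ sy hp))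
  have s2 : px (px (pt u)) p = pt (px (px u)) p :=
    (congrArg (fun L => L (1, 0)) (gs_congr hΩ sy hp)).trans (gs_symm hΩ ca hp)
  have Ex' : 3 * p.1 ^ 2 + px (px u) p - (px (px u) p + pt (pt u) p
      + p.1 * (px (px (px u)) p + px (pt (pt u)) p)) = 0 := by
    simp at Ex
    exact Ex
  have Et' : pt (px u) p - p.1 * (pt (px (px u)) p + pt (pt (pt u)) p) = 0 := by
    simp at Et
    exact Et
  have E0 := E p hp
  simp only at E0
  have s0 := sy p hp
  rw [s1] at Ex'
  unfold GS
  rw [Qxx, Qtt, Qx p hp, s2, s0]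
  field_simp
  linear_combination p.1 * Ex' + p.2 * Et' + E0
end

section
/- For any real constants C₁, C₂, the function u(x,t) = x⁴/8 + C₁ + C₂·t/√(t² + x²) satisfies the Grad–Shafranov equation u_xx − (1/x)·u_x + u_tt = x² at every point (x,t) ∈ ℝ² with x ≠ 0. -/
lemma px_eq_of {u : ℝ × ℝ → ℝ} {p : ℝ × ℝ} {a : ℝ} (h : DifferentiableAt ℝ u p)
    (hd : HasDerivAt (fun s => u (s, p.2)) a p.1) : px u p = a := by
  have h1 : HasDerivAt (fun s : ℝ => (s, p.2)) ((1 : ℝ), (0 : ℝ)) p.1 :=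
    (hasDerivAt_id p.1).prodMk (hasDerivAt_const p.1 p.2)
  have h2 : HasFDerivAt u (fderiv ℝ u p) ((fun s : ℝ => (s, p.2)) p.1) := h.hasFDerivAt
  exact (h2.comp_hasDerivAt p.1 h1).unique hd

lemma pt_eq_of {u : ℝ × ℝ → ℝ} {p : ℝ × ℝ} {a : ℝ} (h : DifferentiableAt ℝ u p)
    (hd : HasDerivAt (fun s => u (p.1, s)) a p.2) : pt u p = a := by
  have h1 : HasDerivAt (fun s : ℝ => (p.1, s)) ((0 : ℝ), (1 : ℝ)) p.2 :=
    (hasDerivAt_const p.2 p.1).prodMk (hasDerivAt_id p.2)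
  have h2 : HasFDerivAt u (fderiv ℝ u p) ((fun s : ℝ => (p.1, s)) p.2) := h.hasFDerivAt
  exact (h2.comp_hasDerivAt p.2 h1).unique hd

lemma diff_div {c d : ℝ × ℝ → ℝ} {p : ℝ × ℝ} (hc : DifferentiableAt ℝ c p)
    (hd : DifferentiableAt ℝ d p) (h : d p ≠ 0) : DifferentiableAt ℝ (fun q => c q / d q) p := by
  simp only [div_eq_mul_inv]
  exact hc.mul (hd.inv h)

lemma r_pos {x t : ℝ} (hx : x ≠ 0) : 0 < t ^ 2 + x ^ 2 := by positivity

lemma r_dx {x t : ℝ} (hx : x ≠ 0) :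
    HasDerivAt (fun s => Real.sqrt (t ^ 2 + s ^ 2)) (x / Real.sqrt (t ^ 2 + x ^ 2)) x := by
  have h := (((hasDerivAt_id x).pow 2).const_add (t ^ 2)).sqrt (r_pos (t := t) hx).ne'
  have hr := (Real.sqrt_pos.2 (r_pos (t := t) hx)).ne'
  refine h.congr_deriv ?_
  simp
  field_simp

lemma r_dt {x t : ℝ} (hx : x ≠ 0) :
    HasDerivAt (fun s => Real.sqrt (s ^ 2 + x ^ 2)) (t / Real.sqrt (t ^ 2 + x ^ 2)) t := by
  have h := (((hasDerivAt_id t).pow 2).add_const (x ^ 2)).sqrt (r_pos (t := t) hx).ne'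
  have hr := (Real.sqrt_pos.2 (r_pos (t := t) hx)).ne'
  refine h.congr_deriv ?_
  simp
  field_simp

lemma r_diff {p : ℝ × ℝ} (hx : p.1 ≠ 0) :
    DifferentiableAt ℝ (fun q : ℝ × ℝ => Real.sqrt (q.2 ^ 2 + q.1 ^ 2)) p := by
  have h : DifferentiableAt ℝ (fun q : ℝ × ℝ => q.2 ^ 2 + q.1 ^ 2) p := by fun_prop
  exact h.sqrt (r_pos hx).ne'

/-- The group-invariant solution of the Grad–Shafranov equation associated with the
symmetry generator `X₂`: for any constants `C₁, C₂`, the function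
`u(x,t) = x⁴/8 + C₁ + C₂ t / √(t² + x²)` satisfies
`u_xx − (1/x) u_x + u_tt = x²` wherever `x ≠ 0`. -/
theorem grad_shafranov_X2_invariant_solution (C₁ C₂ : ℝ) :
    ∀ p : ℝ × ℝ, p.1 ≠ 0 →
      GS (fun q => q.1 ^ 4 / 8 + C₁ + C₂ * q.2 / Real.sqrt (q.2 ^ 2 + q.1 ^ 2)) p
        = p.1 ^ 2 := by
  have hdiff : ∀ p : ℝ × ℝ, p.1 ≠ 0 → DifferentiableAt ℝ (fun q : ℝ × ℝ =>
      q.1 ^ 4 / 8 + C₁ + C₂ * q.2 / Real.sqrt (q.2 ^ 2 + q.1 ^ 2)) p := by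
    intro p hp
    have hr := (Real.sqrt_pos.2 (r_pos (t := p.2) hp)).ne'
    have := r_diff hp
    exact DifferentiableAt.add (by fun_prop)
      (diff_div (c := fun q : ℝ × ℝ => C₂ * q.2) (by fun_prop) this hr)
  have hpx : ∀ p : ℝ × ℝ, p.1 ≠ 0 → px (fun q : ℝ × ℝ =>
      q.1 ^ 4 / 8 + C₁ + C₂ * q.2 / Real.sqrt (q.2 ^ 2 + q.1 ^ 2)) p
      = p.1 ^ 3 / 2 - C₂ * p.2 * p.1 / Real.sqrt (p.2 ^ 2 + p.1 ^ 2) ^ 3 := by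
    intro p hp
    have hr := (Real.sqrt_pos.2 (r_pos (t := p.2) hp)).ne'
    refine px_eq_of (hdiff p hp) ?_
    refine (((((hasDerivAt_id p.1).pow 4).div_const 8).add_const C₁).add
      ((hasDerivAt_const p.1 (C₂ * p.2)).div (r_dx hp) hr)).congr_deriv ?_
    simp
    field_simp
    ring
  have hpt : ∀ p : ℝ × ℝ, p.1 ≠ 0 → pt (fun q : ℝ × ℝ =>
      q.1 ^ 4 / 8 + C₁ + C₂ * q.2 / Real.sqrt (q.2 ^ 2 + q.1 ^ 2)) p
      = C₂ * p.1 ^ 2 / Real.sqrt (p.2 ^ 2 + p.1 ^ 2) ^ 3 := by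
    intro p hp
    have hr := (Real.sqrt_pos.2 (r_pos (t := p.2) hp)).ne'
    have hs := Real.sq_sqrt (r_pos (t := p.2) hp).le
    refine pt_eq_of (hdiff p hp) ?_
    refine ((((hasDerivAt_id p.2).const_mul C₂).div (r_dt hp) hr).const_add
      (p.1 ^ 4 / 8 + C₁)).congr_deriv ?_
    simp only [id]
    generalize Real.sqrt (p.2 ^ 2 + p.1 ^ 2) = r at *
    field_simp
    rw [hs]
    ring
  intro p hp
  have hr := (Real.sqrt_pos.2 (r_pos (t := p.2) hp)).ne'
  have hev : ∀ᶠ q : ℝ × ℝ in nhds p, q.1 ≠ 0 :=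
    continuous_fst.continuousAt.eventually_ne hp
  have hrd := r_diff hp
  have hxx : px (px (fun q : ℝ × ℝ =>
      q.1 ^ 4 / 8 + C₁ + C₂ * q.2 / Real.sqrt (q.2 ^ 2 + q.1 ^ 2))) p
      = 3 * p.1 ^ 2 / 2 - C₂ * p.2 / Real.sqrt (p.2 ^ 2 + p.1 ^ 2) ^ 3
        + 3 * C₂ * p.2 * p.1 ^ 2 / Real.sqrt (p.2 ^ 2 + p.1 ^ 2) ^ 5 := by
    rw [px, (show _ =ᶠ[nhds p] _ from hev.mono hpx).fderiv_eq]
    refine px_eq_of (u := fun p : ℝ × ℝ =>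
      p.1 ^ 3 / 2 - C₂ * p.2 * p.1 / Real.sqrt (p.2 ^ 2 + p.1 ^ 2) ^ 3) ?_ ?_
    · exact DifferentiableAt.sub (by fun_prop)
        (diff_div (c := fun q : ℝ × ℝ => C₂ * q.2 * q.1) (by fun_prop) (hrd.pow 3) (pow_ne_zero 3 hr))
    · refine ((((hasDerivAt_id p.1).pow 3).div_const 2).sub
        (((hasDerivAt_id p.1).const_mul (C₂ * p.2)).div ((r_dx hp).pow 3)
          (pow_ne_zero 3 hr))).congr_deriv ?_
      simp
      field_simp
      ring
  have htt : pt (pt (fun q : ℝ × ℝ =>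
      q.1 ^ 4 / 8 + C₁ + C₂ * q.2 / Real.sqrt (q.2 ^ 2 + q.1 ^ 2))) p
      = - (3 * C₂ * p.2 * p.1 ^ 2 / Real.sqrt (p.2 ^ 2 + p.1 ^ 2) ^ 5) := by
    rw [pt, (show _ =ᶠ[nhds p] _ from hev.mono hpt).fderiv_eq]
    refine pt_eq_of (u := fun p : ℝ × ℝ =>
      C₂ * p.1 ^ 2 / Real.sqrt (p.2 ^ 2 + p.1 ^ 2) ^ 3) ?_ ?_
    · exact diff_div (c := fun q : ℝ × ℝ => C₂ * q.1 ^ 2) (by fun_prop) (hrd.pow 3) (pow_ne_zero 3 hr)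
    · refine ((hasDerivAt_const p.2 (C₂ * p.1 ^ 2)).div ((r_dt hp).pow 3)
          (pow_ne_zero 3 hr)).congr_deriv ?_
      simp
      field_simp
  rw [GS, hxx, htt, hpx p hp]
  field_simp
  ring
end

section
/- For any real constants C₁, C₂, the function u(x,t) = x⁴/8 + C₁·x²·(t² + x²)^{−3/2} + C₂·√(t² + x²) satisfies the Grad–Shafranov equation u_xx − (1/x)·u_x + u_tt = x² at every point (x,t) ∈ ℝ² with x ≠ 0. -/
theorem px_eq {u : ℝ × ℝ → ℝ} {x t d : ℝ} (hd : DifferentiableAt ℝ u (x, t))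
    (h : HasDerivAt (fun y => u (y, t)) d x) : px u (x, t) = d := by
  have h1 : HasDerivAt (fun y : ℝ => (y, t)) ((1 : ℝ), (0 : ℝ)) x :=
    (hasDerivAt_id x).prodMk (hasDerivAt_const x t)
  exact (hd.hasFDerivAt.comp_hasDerivAt x h1).unique h

theorem pt_eq {u : ℝ × ℝ → ℝ} {x t d : ℝ} (hd : DifferentiableAt ℝ u (x, t))
    (h : HasDerivAt (fun y => u (x, y)) d t) : pt u (x, t) = d := by
  have h1 : HasDerivAt (fun y : ℝ => (x, y)) ((0 : ℝ), (1 : ℝ)) t :=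
    (hasDerivAt_const t x).prodMk (hasDerivAt_id t)
  exact (hd.hasFDerivAt.comp_hasDerivAt t h1).unique h

/-- The radius. -/
noncomputable def rad (q : ℝ × ℝ) : ℝ := Real.sqrt (q.2 ^ 2 + q.1 ^ 2)

theorem base_pos {x : ℝ} (t : ℝ) (hx : x ≠ 0) : 0 < t ^ 2 + x ^ 2 := by positivity

theorem rad_pos {x : ℝ} (t : ℝ) (hx : x ≠ 0) : 0 < rad (x, t) :=
  Real.sqrt_pos.2 (base_pos t hx)

theorem rad_sq (x t : ℝ) : rad (x, t) ^ 2 = t ^ 2 + x ^ 2 :=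
  Real.sq_sqrt (by positivity)

theorem rad_diff {x : ℝ} (t : ℝ) (hx : x ≠ 0) : DifferentiableAt ℝ rad (x, t) := by
  unfold rad
  exact DifferentiableAt.sqrt (by fun_prop) (base_pos t hx).ne'

theorem rad_dx {x : ℝ} (t : ℝ) (hx : x ≠ 0) :
    HasDerivAt (fun y => rad (y, t)) (x / rad (x, t)) x := by
  have h := (((hasDerivAt_id x).pow 2).const_add (t ^ 2)).sqrt (base_pos t hx).ne'
  have := rad_pos t hx
  refine h.congr_deriv ?_
  unfold rad at *
  simp at *
  field_simp

theorem rad_dt {x : ℝ} (t : ℝ) (hx : x ≠ 0) :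
    HasDerivAt (fun y => rad (x, y)) (t / rad (x, t)) t := by
  have h := (((hasDerivAt_id t).pow 2).add_const (x ^ 2)).sqrt (base_pos t hx).ne'
  have := rad_pos t hx
  refine h.congr_deriv ?_
  unfold rad at *
  simp at *
  field_simp

/-- The solution via the radius. -/
noncomputable def uu (a b : ℝ) (q : ℝ × ℝ) : ℝ :=
  q.1 ^ 4 / 8 + a * q.1 ^ 2 / rad q ^ 3 + b * rad q

/-- Its x-derivative. -/
noncomputable def ux (a b : ℝ) (q : ℝ × ℝ) : ℝ :=
  q.1 ^ 3 / 2 + a * (2 * q.1 / rad q ^ 3 - 3 * q.1 ^ 3 / rad q ^ 5) + b * q.1 / rad q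

/-- Its t-derivative. -/
noncomputable def ut (a b : ℝ) (q : ℝ × ℝ) : ℝ :=
  - (3 * a * q.1 ^ 2 * q.2 / rad q ^ 5) + b * q.2 / rad q

theorem uu_eq (a b : ℝ) :
    (fun q : ℝ × ℝ => q.1 ^ 4 / 8 + a * q.1 ^ 2 * (q.2 ^ 2 + q.1 ^ 2) ^ (-(3 : ℝ) / 2)
        + b * Real.sqrt (q.2 ^ 2 + q.1 ^ 2)) = uu a b := by
  funext q
  have h0 : 0 ≤ q.2 ^ 2 + q.1 ^ 2 := by positivity
  have : (q.2 ^ 2 + q.1 ^ 2) ^ (-(3 : ℝ) / 2) = (rad q ^ 3)⁻¹ := by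
    unfold rad
    generalize q.2 ^ 2 + q.1 ^ 2 = w at *
    rw [Real.sqrt_eq_rpow, ← Real.rpow_natCast _ 3, ← Real.rpow_mul h0, ← Real.rpow_neg h0]
    norm_num
  rw [this, uu, rad, div_eq_mul_inv (a * q.1 ^ 2)]

theorem px_uu (a b : ℝ) {x : ℝ} (t : ℝ) (hx : x ≠ 0) : px (uu a b) (x, t) = ux a b (x, t) := by
  have hr := rad_pos t hx
  have hd := rad_diff t hx
  have hn := hr.ne'
  apply px_eq
  · unfold uu
    fun_prop (disch := positivity)
  · have h := rad_dx t hx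
    have hi := hasDerivAt_id x
    have := ((((hi.pow 4).div_const 8).add (((hi.pow 2).const_mul a).div (h.pow 3)
      (pow_ne_zero 3 hn))).add (h.const_mul b))
    refine this.congr_deriv ?_
    simp only [ux, id, Pi.pow_apply]
    field_simp
    ring

theorem pt_uu (a b : ℝ) {x : ℝ} (t : ℝ) (hx : x ≠ 0) : pt (uu a b) (x, t) = ut a b (x, t) := by
  have hr := rad_pos t hx
  have hd := rad_diff t hx
  have hn := hr.ne'
  apply pt_eq
  · unfold uu
    fun_prop (disch := positivity)
  · have h := rad_dt t hx
    have := (((hasDerivAt_const t (x ^ 4 / 8)).add ((hasDerivAt_const t (a * x ^ 2)).div (h.pow 3)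
      (pow_ne_zero 3 hn))).add (h.const_mul b))
    refine this.congr_deriv ?_
    simp only [ut, id, Pi.pow_apply]
    field_simp
    ring

theorem px_ux (a b : ℝ) {x : ℝ} (t : ℝ) (hx : x ≠ 0) : px (ux a b) (x, t) =
    3 * x ^ 2 / 2 + a * (2 / rad (x, t) ^ 3 - 15 * x ^ 2 / rad (x, t) ^ 5
      + 15 * x ^ 4 / rad (x, t) ^ 7) + b * (1 / rad (x, t) - x ^ 2 / rad (x, t) ^ 3) := by
  have hr := rad_pos t hx
  have hd := rad_diff t hx
  have hn := hr.ne'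
  apply px_eq
  · unfold ux
    fun_prop (disch := positivity)
  · have h := rad_dx t hx
    have hi := hasDerivAt_id x
    have := ((((hi.pow 3).div_const 2).add ((((hi.const_mul 2).div (h.pow 3)
      (pow_ne_zero 3 hn)).sub (((hi.pow 3).const_mul 3).div (h.pow 5)
      (pow_ne_zero 5 hn))).const_mul a)).add ((hi.const_mul b).div h hn))
    refine this.congr_deriv ?_
    simp only [id, Pi.pow_apply]
    field_simp
    ring

theorem pt_ut (a b : ℝ) {x : ℝ} (t : ℝ) (hx : x ≠ 0) : pt (ut a b) (x, t) =
    a * (- (3 * x ^ 2 / rad (x, t) ^ 5) + 15 * x ^ 2 * t ^ 2 / rad (x, t) ^ 7)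
      + b * (1 / rad (x, t) - t ^ 2 / rad (x, t) ^ 3) := by
  have hr := rad_pos t hx
  have hd := rad_diff t hx
  have hn := hr.ne'
  apply pt_eq
  · unfold ut
    fun_prop (disch := positivity)
  · have h := rad_dt t hx
    have hi := hasDerivAt_id t
    have := (((hi.const_mul (3 * a * x ^ 2)).div (h.pow 5)
      (pow_ne_zero 5 hn)).neg).add ((hi.const_mul b).div h hn)
    refine this.congr_deriv ?_
    simp only [id, Pi.pow_apply]
    field_simp
    ring

/-- The group-invariant solution of the Grad–Shafranov equation associated with the
symmetry generator `X₄`: for any constants `C₁, C₂`, the function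
`u(x,t) = x⁴/8 + C₁ x² (t² + x²)^{−3/2} + C₂ √(t² + x²)` satisfies
`u_xx − (1/x) u_x + u_tt = x²` wherever `x ≠ 0`. -/
theorem grad_shafranov_X4_invariant_solution (C₁ C₂ : ℝ) :
    ∀ p : ℝ × ℝ, p.1 ≠ 0 →
      GS (fun q => q.1 ^ 4 / 8 + C₁ * q.1 ^ 2 * (q.2 ^ 2 + q.1 ^ 2) ^ (-(3 : ℝ) / 2)
        + C₂ * Real.sqrt (q.2 ^ 2 + q.1 ^ 2)) p = p.1 ^ 2 := by
  rintro ⟨x, t⟩ hx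
  replace hx : x ≠ 0 := hx
  rw [uu_eq]
  have hev : ∀ᶠ q : ℝ × ℝ in nhds (x, t), q.1 ≠ 0 :=
    continuous_fst.continuousAt.eventually_ne hx
  have e1 : px (px (uu C₁ C₂)) (x, t) = px (ux C₁ C₂) (x, t) := by
    have : px (uu C₁ C₂) =ᶠ[nhds (x, t)] ux C₁ C₂ := by
      filter_upwards [hev] with q hq using px_uu C₁ C₂ q.2 hq
    unfold px at this ⊢
    rw [this.fderiv_eq]
  have e2 : pt (pt (uu C₁ C₂)) (x, t) = pt (ut C₁ C₂) (x, t) := by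
    have : pt (uu C₁ C₂) =ᶠ[nhds (x, t)] ut C₁ C₂ := by
      filter_upwards [hev] with q hq using pt_uu C₁ C₂ q.2 hq
    unfold pt at this ⊢
    rw [this.fderiv_eq]
  rw [GS, e1, e2, px_uu C₁ C₂ t hx, px_ux C₁ C₂ t hx, pt_ut C₁ C₂ t hx]
  have hn := (rad_pos t hx).ne'
  have ht : t ^ 2 = rad (x, t) ^ 2 - x ^ 2 := by rw [rad_sq]; ring
  rw [ht]
  simp only [ux]
  generalize rad (x, t) = r at *
  field_simp
  ring
end

section
/- For any real constants C₁, C₂, the function u(x,t) = x⁴/8 + C₂·√(t² + x²) + C₁·t satisfies the Grad–Shafranov equation u_xx − (1/x)·u_x + u_tt = x² at every point (x,t) ∈ ℝ² with x ≠ 0. -/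
lemma gs_hr (p : ℝ × ℝ) (hp : p.1 ≠ 0) :
    HasFDerivAt (fun q : ℝ × ℝ => Real.sqrt (q.2 ^ 2 + q.1 ^ 2))
      ((p.1 / Real.sqrt (p.2 ^ 2 + p.1 ^ 2)) • ContinuousLinearMap.fst ℝ ℝ ℝ +
        (p.2 / Real.sqrt (p.2 ^ 2 + p.1 ^ 2)) • ContinuousLinearMap.snd ℝ ℝ ℝ) p := by
  have hpos : 0 < p.2 ^ 2 + p.1 ^ 2 := by positivity
  have hs : 0 < Real.sqrt (p.2 ^ 2 + p.1 ^ 2) := Real.sqrt_pos.mpr hpos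
  have h1 : HasFDerivAt (fun q : ℝ × ℝ => q.1) (ContinuousLinearMap.fst ℝ ℝ ℝ) p := hasFDerivAt_fst
  have h2 : HasFDerivAt (fun q : ℝ × ℝ => q.2) (ContinuousLinearMap.snd ℝ ℝ ℝ) p := hasFDerivAt_snd
  refine (((h2.pow 2).add (h1.pow 2)).sqrt hpos.ne').congr_fderiv ?_
  ext <;> simp <;> field_simp

lemma gs_hu (C₁ C₂ : ℝ) (p : ℝ × ℝ) (hp : p.1 ≠ 0) :
    HasFDerivAt (fun q : ℝ × ℝ => q.1 ^ 4 / 8 + C₂ * Real.sqrt (q.2 ^ 2 + q.1 ^ 2) + C₁ * q.2)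
      ((p.1 ^ 3 / 2 + C₂ * (p.1 / Real.sqrt (p.2 ^ 2 + p.1 ^ 2))) •
          ContinuousLinearMap.fst ℝ ℝ ℝ +
        (C₂ * (p.2 / Real.sqrt (p.2 ^ 2 + p.1 ^ 2)) + C₁) •
          ContinuousLinearMap.snd ℝ ℝ ℝ) p := by
  have h1 : HasFDerivAt (fun q : ℝ × ℝ => q.1) (ContinuousLinearMap.fst ℝ ℝ ℝ) p := hasFDerivAt_fst
  have h2 : HasFDerivAt (fun q : ℝ × ℝ => q.2) (ContinuousLinearMap.snd ℝ ℝ ℝ) p := hasFDerivAt_snd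
  have h := (((h1.pow 4).mul_const (8⁻¹ : ℝ)).add ((gs_hr p hp).const_mul C₂)).add
    (h2.const_mul C₁)
  refine h.congr_fderiv ?_
  ext
  · simp
    ring
  · simp

/-- The group-invariant solution of the Grad–Shafranov equation associated with the
symmetry generator `X₂ + X₃`: for any constants `C₁, C₂`, the function
`u(x,t) = x⁴/8 + C₂ √(t² + x²) + C₁ t` satisfies
`u_xx − (1/x) u_x + u_tt = x²` wherever `x ≠ 0`. -/
theorem grad_shafranov_X2_X3_invariant_solution (C₁ C₂ : ℝ) :
    ∀ p : ℝ × ℝ, p.1 ≠ 0 →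
      GS (fun q => q.1 ^ 4 / 8 + C₂ * Real.sqrt (q.2 ^ 2 + q.1 ^ 2) + C₁ * q.2) p
        = p.1 ^ 2 := by
  intro p hp
  have hpos : 0 < p.2 ^ 2 + p.1 ^ 2 := by positivity
  have hs : 0 < Real.sqrt (p.2 ^ 2 + p.1 ^ 2) := Real.sqrt_pos.mpr hpos
  have hsq : Real.sqrt (p.2 ^ 2 + p.1 ^ 2) ^ 2 = p.2 ^ 2 + p.1 ^ 2 := Real.sq_sqrt hpos.le
  have h1 : HasFDerivAt (fun q : ℝ × ℝ => q.1) (ContinuousLinearMap.fst ℝ ℝ ℝ) p := hasFDerivAt_fst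
  have h2 : HasFDerivAt (fun q : ℝ × ℝ => q.2) (ContinuousLinearMap.snd ℝ ℝ ℝ) p := hasFDerivAt_snd
  have hinv := (hasDerivAt_inv hs.ne').comp_hasFDerivAt p (gs_hr p hp)
  have hne : ∀ᶠ q : ℝ × ℝ in nhds p, q.1 ≠ 0 :=
    continuous_fst.continuousAt.eventually_ne hp
  have ex : px (fun q => q.1 ^ 4 / 8 + C₂ * Real.sqrt (q.2 ^ 2 + q.1 ^ 2) + C₁ * q.2)
      =ᶠ[nhds p] fun q => q.1 ^ 3 * 2⁻¹ + C₂ * (q.1 * (Real.sqrt (q.2 ^ 2 + q.1 ^ 2))⁻¹) := by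
    filter_upwards [hne] with q hq
    rw [px, (gs_hu C₁ C₂ q hq).fderiv]
    simp [div_eq_mul_inv]
  have et : pt (fun q => q.1 ^ 4 / 8 + C₂ * Real.sqrt (q.2 ^ 2 + q.1 ^ 2) + C₁ * q.2)
      =ᶠ[nhds p] fun q => C₂ * (q.2 * (Real.sqrt (q.2 ^ 2 + q.1 ^ 2))⁻¹) + C₁ := by
    filter_upwards [hne] with q hq
    rw [pt, (gs_hu C₁ C₂ q hq).fderiv]
    simp [div_eq_mul_inv]
  have dx := ((h1.pow 3).mul_const (2⁻¹ : ℝ)).add ((h1.mul hinv).const_mul C₂)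
  have dt := ((h2.mul hinv).const_mul C₂).add_const C₁
  have vx := (dx.congr_of_eventuallyEq ex).fderiv
  have vt := (dt.congr_of_eventuallyEq et).fderiv
  rw [GS, ex.eq_of_nhds, px, pt, vx, vt]
  simp
  generalize Real.sqrt (p.2 ^ 2 + p.1 ^ 2) = r at *
  have ht : p.2 ^ 2 = r ^ 2 - p.1 ^ 2 := by linarith
  field_simp
  ring_nf
  try simp only [ht]
  try ring
end

section
/- Let f : ℝ → ℝ be twice differentiable on (0,∞) and satisfy Bessel's equation of order one, x²·f''(x) + x·f'(x) + (x² − 1)·f(x) = 0, for all x > 0. Then the function u(x,t) = x·(x³/8 + e^{t}·f(x)) = x⁴/8 + e^{t}·x·f(x) satisfies the Grad–Shafranov equation u_xx − (1/x)·u_x + u_tt = x² at every point (x,t) with x > 0. -/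
lemma px_pt_aux (A B : ℝ → ℝ) (a b : ℝ) (p : ℝ × ℝ) (hA : HasDerivAt A a p.1)
    (hB : HasDerivAt B b p.1) :
    px (fun q => A q.1 + Real.exp q.2 * B q.1) p = a + Real.exp p.2 * b ∧
    pt (fun q => A q.1 + Real.exp q.2 * B q.1) p = Real.exp p.2 * B p.1 := by
  have h1 : HasFDerivAt (fun q : ℝ × ℝ => q.1) (ContinuousLinearMap.fst ℝ ℝ ℝ) p := hasFDerivAt_fst
  have h2 : HasFDerivAt (fun q : ℝ × ℝ => q.2) (ContinuousLinearMap.snd ℝ ℝ ℝ) p := hasFDerivAt_snd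
  have hA1 := hA.comp_hasFDerivAt p h1
  have hB1 := hB.comp_hasFDerivAt p h1
  have hE := (Real.hasDerivAt_exp p.2).comp_hasFDerivAt p h2
  have h := (hA1.add (hE.mul hB1)).fderiv
  have h' : fderiv ℝ (fun q : ℝ × ℝ => A q.1 + Real.exp q.2 * B q.1) p = _ := h
  unfold px pt
  rw [h']
  constructor <;> simp [mul_comm]

lemma px_congr_s15 {u v : ℝ × ℝ → ℝ} (h : ∀ q : ℝ × ℝ, 0 < q.1 → u q = v q) (p : ℝ × ℝ)
    (hp : 0 < p.1) : px u p = px v p ∧ pt u p = pt v p := by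
  have : u =ᶠ[nhds p] v := by
    filter_upwards [(isOpen_lt continuous_const continuous_fst).mem_nhds hp] with q hq
    exact h q hq
  unfold px pt
  rw [this.fderiv_eq]
  exact ⟨rfl, rfl⟩

/-- The group-invariant solution of the Grad–Shafranov equation associated with the
symmetry generator `X₁ + X₃`: if `f` is twice differentiable on `(0,∞)` and solves
Bessel's equation of order one, `x² f'' + x f' + (x² − 1) f = 0` for `x > 0`, then
`u(x,t) = x (x³/8 + e^t f(x)) = x⁴/8 + e^t x f(x)` satisfies
`u_xx − (1/x) u_x + u_tt = x²` wherever `x > 0`. -/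
theorem grad_shafranov_bessel_invariant_solution (f : ℝ → ℝ)
    (hf : ∀ x ∈ Set.Ioi (0 : ℝ), DifferentiableAt ℝ f x)
    (hf' : ∀ x ∈ Set.Ioi (0 : ℝ), DifferentiableAt ℝ (deriv f) x)
    (hbessel : ∀ x > (0 : ℝ),
      x ^ 2 * deriv (deriv f) x + x * deriv f x + (x ^ 2 - 1) * f x = 0) :
    ∀ p : ℝ × ℝ, 0 < p.1 →
      GS (fun q => q.1 * (q.1 ^ 3 / 8 + Real.exp q.2 * f q.1)) p = p.1 ^ 2 := by
  intro p hp
  have hu : (fun q : ℝ × ℝ => q.1 * (q.1 ^ 3 / 8 + Real.exp q.2 * f q.1)) =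
      fun q => (fun x : ℝ => x ^ 4 / 8) q.1 + Real.exp q.2 * (fun x => x * f x) q.1 := by
    funext q
    ring
  have dA (x : ℝ) : HasDerivAt (fun x : ℝ => x ^ 4 / 8) (x ^ 3 / 2) x := by
    have h := (hasDerivAt_pow 4 x).div_const 8
    have e : ((4 : ℕ) : ℝ) * x ^ (4 - 1) / 8 = x ^ 3 / 2 := by
      norm_num
      ring
    exact e ▸ h
  have dA2 (x : ℝ) : HasDerivAt (fun x : ℝ => x ^ 3 / 2) (3 * x ^ 2 / 2) x := by
    have h := (hasDerivAt_pow 3 x).div_const 2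
    have e : ((3 : ℕ) : ℝ) * x ^ (3 - 1) / 2 = 3 * x ^ 2 / 2 := by
      norm_num
    exact e ▸ h
  have dB (x : ℝ) (hx : 0 < x) : HasDerivAt (fun x => x * f x) (f x + x * deriv f x) x := by
    have h := (hasDerivAt_id' x).mul (hf x hx).hasDerivAt
    rw [one_mul] at h
    exact h
  have dB2 (x : ℝ) (hx : 0 < x) : HasDerivAt (fun x => f x + x * deriv f x)
      (deriv f x + (deriv f x + x * deriv (deriv f) x)) x := by
    have h := (hf x hx).hasDerivAt.add ((hasDerivAt_id' x).mul (hf' x hx).hasDerivAt)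
    rw [one_mul] at h
    exact h
  have k1 (q : ℝ × ℝ) (hq : 0 < q.1) := px_pt_aux _ _ _ _ q (dA q.1) (dB q.1 hq)
  have k2 := px_pt_aux _ _ _ _ p (dA2 p.1) (dB2 p.1 hp)
  have k3 := px_pt_aux (fun _ => 0) _ _ _ p (hasDerivAt_const p.1 0) (dB p.1 hp)
  have e1 := (px_congr_s15 (v := fun q => (fun x : ℝ => x ^ 3 / 2) q.1 +
    Real.exp q.2 * (fun x => f x + x * deriv f x) q.1) (fun q hq => (k1 q hq).1) p hp).1
  have e2 := (px_congr_s15 (v := fun q => (fun _ : ℝ => (0 : ℝ)) q.1 +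
    Real.exp q.2 * (fun x => x * f x) q.1)
    (fun q hq => (k1 q hq).2.trans (zero_add _).symm) p hp).2
  rw [hu]
  unfold GS
  rw [e1, e2, k2.1, k3.2, (k1 p hp).1]
  have hb := hbessel p.1 hp
  have hne := hp.ne'
  field_simp
  linear_combination 2 * Real.exp p.2 * hb
end

section
/- Let f : ℝ → ℝ be twice differentiable on (0,∞) and satisfy the modified Bessel equation of order one, x²·f''(x) + x·f'(x) − (x² + 1)·f(x) = 0, for all x > 0. Then the function u(x,t) = −x² + x·f(x) satisfies the equation u_xx − (1/x)·u_x + u_tt = x² + u at every point (x,t) with x > 0. -/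
/-- Derivative of a function depending on the first coordinate only. -/
theorem hasFDerivAt_comp_fst_aux (g : ℝ → ℝ) (g' : ℝ) (q : ℝ × ℝ) (h : HasDerivAt g g' q.1) :
    HasFDerivAt (fun r : ℝ × ℝ => g r.1) (g' • ContinuousLinearMap.fst ℝ ℝ ℝ) q :=
  h.comp_hasFDerivAt q hasFDerivAt_fst

/-- The invariant solution for the time-translation symmetry of the equation
`u_xx − (1/x) u_x + u_tt = x² + u` (equation (1) of the paper with `a = −1`,
`p = 2`, `F ≡ 1`, `G(u) = u`): if `f` is twice differentiable on `(0,∞)` and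
solves the modified Bessel equation of order one,
`x² f'' + x f' − (x² + 1) f = 0` for `x > 0`, then `u(x,t) = −x² + x f(x)`
satisfies `u_xx − (1/x) u_x + u_tt = x² + u` wherever `x > 0`. -/
theorem grad_shafranov_modified_bessel_invariant_solution (f : ℝ → ℝ)
    (hf : ∀ x ∈ Set.Ioi (0 : ℝ), DifferentiableAt ℝ f x)
    (hf' : ∀ x ∈ Set.Ioi (0 : ℝ), DifferentiableAt ℝ (deriv f) x)
    (hbessel : ∀ x > (0 : ℝ),
      x ^ 2 * deriv (deriv f) x + x * deriv f x - (x ^ 2 + 1) * f x = 0) :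
    ∀ p : ℝ × ℝ, 0 < p.1 →
      GS (fun q => -q.1 ^ 2 + q.1 * f q.1) p
        = p.1 ^ 2 + (-p.1 ^ 2 + p.1 * f p.1) := by
  intro p hp
  have hu : ∀ x > (0 : ℝ), HasDerivAt (fun x => -x ^ 2 + x * f x)
      (-(2 * x) + (f x + x * deriv f x)) x := by
    intro x hx
    have h1 := ((hasDerivAt_id x).pow 2).neg.add ((hasDerivAt_id x).mul (hf x hx).hasDerivAt)
    exact h1.congr_deriv (by simp)
  have hux : ∀ x > (0 : ℝ), HasDerivAt (fun x => -(2 * x) + (f x + x * deriv f x))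
      (-2 + (deriv f x + (deriv f x + x * deriv (deriv f) x))) x := by
    intro x hx
    have h1 := ((hasDerivAt_id x).const_mul 2).neg.add
      ((hf x hx).hasDerivAt.add ((hasDerivAt_id x).mul (hf' x hx).hasDerivAt))
    exact h1.congr_deriv (by simp)
  have hd : ∀ q : ℝ × ℝ, 0 < q.1 → px (fun q => -q.1 ^ 2 + q.1 * f q.1) q
      = -(2 * q.1) + (f q.1 + q.1 * deriv f q.1) := by
    intro q hq
    rw [px, (hasFDerivAt_comp_fst_aux _ _ q (hu _ hq)).fderiv]
    simp
  have ht : ∀ q : ℝ × ℝ, 0 < q.1 → pt (fun q => -q.1 ^ 2 + q.1 * f q.1) q = 0 := by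
    intro q hq
    rw [pt, (hasFDerivAt_comp_fst_aux _ _ q (hu _ hq)).fderiv]
    simp
  have hev : ∀ᶠ q : ℝ × ℝ in nhds p, 0 < q.1 :=
    continuous_fst.continuousAt.eventually (lt_mem_nhds hp)
  have hxx : px (px (fun q => -q.1 ^ 2 + q.1 * f q.1)) p
      = -2 + (deriv f p.1 + (deriv f p.1 + p.1 * deriv (deriv f) p.1)) := by
    have he : px (fun q => -q.1 ^ 2 + q.1 * f q.1) =ᶠ[nhds p]
        fun q => -(2 * q.1) + (f q.1 + q.1 * deriv f q.1) := hev.mono hd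
    rw [px, he.fderiv_eq, (hasFDerivAt_comp_fst_aux _ _ p (hux _ hp)).fderiv]
    simp
  have htt : pt (pt (fun q => -q.1 ^ 2 + q.1 * f q.1)) p = 0 := by
    have he : pt (fun q => -q.1 ^ 2 + q.1 * f q.1) =ᶠ[nhds p] fun _ => (0 : ℝ) := hev.mono ht
    rw [pt, he.fderiv_eq]
    simp
  rw [GS, hxx, htt, hd p hp]
  have hb := hbessel p.1 hp
  have hne : p.1 ≠ 0 := hp.ne'
  field_simp
  linear_combination hb
end

section
/- Define Shi(y) = ∫₀^y sinh(t)/t dt and Chi(y) = γ + log(y) + ∫₀^y (cosh(t) − 1)/t dt for y > 0, where γ is the Euler–Mascheroni constant. Then for any real constants C₁, C₂, the function u(x,t) = cosh(x²/2)·(C₁ − (1/2)·Shi(x²/2)) + sinh(x²/2)·(C₂ + (1/2)·Chi(x²/2)) (independent of t) satisfies the equation u_xx − (1/x)·u_x + u_tt = x²·u + 1 at every point (x,t) with x > 0. -/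
/-- The hyperbolic sine integral `Shi(y) = ∫₀^y sinh(t)/t dt`. -/
noncomputable def Shi (y : ℝ) : ℝ := ∫ t in (0 : ℝ)..y, Real.sinh t / t

/-- The hyperbolic cosine integral
`Chi(y) = γ + log y + ∫₀^y (cosh(t) − 1)/t dt`, `γ` the Euler–Mascheroni constant. -/
noncomputable def Chi (y : ℝ) : ℝ :=
  Real.eulerMascheroniConstant + Real.log y + ∫ t in (0 : ℝ)..y, (Real.cosh t - 1) / t

theorem aux_int (f : ℝ → ℝ) (hf : Differentiable ℝ f) (h0 : f 0 = 0) (y : ℝ) (hy : 0 < y) :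
    HasDerivAt (fun y => ∫ t in (0 : ℝ)..y, f t / t) (f y / y) y := by
  have hc : Continuous (dslope f 0) := by
    rw [continuous_iff_continuousAt]
    intro x
    by_cases hx : x = 0
    · subst hx
      exact continuousAt_dslope_same.2 (hf 0)
    · exact (continuousAt_dslope_of_ne hx).2 (hf x).continuousAt
  have he : ∀ t : ℝ, t ≠ 0 → f t / t = dslope f 0 t := by
    intro t ht
    rw [dslope_of_ne _ ht, slope_def_field, h0, sub_zero, sub_zero]
  have hi : (fun y => ∫ t in (0 : ℝ)..y, f t / t) = fun y => ∫ t in (0 : ℝ)..y, dslope f 0 t := by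
    funext y
    apply intervalIntegral.integral_congr_ae
    have : ∀ᵐ t : ℝ, t ≠ 0 := by
      simp [MeasureTheory.ae_iff]
    filter_upwards [this] with t ht _
    exact he t ht
  rw [hi, he y hy.ne']
  exact hc.integral_hasStrictDerivAt 0 y |>.hasDerivAt

theorem aux_Shi (y : ℝ) (hy : 0 < y) : HasDerivAt Shi (Real.sinh y / y) y :=
  aux_int Real.sinh Real.differentiable_sinh Real.sinh_zero y hy

theorem aux_Chi (y : ℝ) (hy : 0 < y) : HasDerivAt Chi (Real.cosh y / y) y := by
  have h := aux_int (fun t => Real.cosh t - 1) (Real.differentiable_cosh.sub_const 1) (by simp) y hy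
  have h2 := ((Real.hasDerivAt_log hy.ne').const_add Real.eulerMascheroniConstant).add h
  refine h2.congr_deriv ?_
  field_simp
  ring

theorem aux_px (g : ℝ → ℝ) (g' : ℝ) (u : ℝ × ℝ → ℝ) (p : ℝ × ℝ)
    (hu : u =ᶠ[nhds p] fun q => g q.1) (hg : HasDerivAt g g' p.1) :
    px u p = g' ∧ pt u p = 0 := by
  have h : HasFDerivAt (fun q : ℝ × ℝ => g q.1) (g' • ContinuousLinearMap.fst ℝ ℝ ℝ) p :=
    hg.comp_hasFDerivAt p hasFDerivAt_fst
  have h2 := (h.congr_of_eventuallyEq hu).fderiv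
  simp [px, pt, h2]

theorem aux_sq (x : ℝ) : HasDerivAt (fun x : ℝ => x ^ 2 / 2) x x := by
  refine (((hasDerivAt_id x).pow 2).div_const 2).congr_deriv ?_
  simp

/-- The invariant solution for the time-translation symmetry of the equation
`u_xx − (1/x) u_x + u_tt = x² u + 1` (equation (1) of the paper with `a = −1`,
`p = 2`, `F(u) = u`, `G ≡ 1`): for any constants `C₁, C₂`, the `t`-independent
function `u(x,t) = cosh(x²/2) (C₁ − (1/2) Shi(x²/2)) + sinh(x²/2) (C₂ + (1/2) Chi(x²/2))`
satisfies `u_xx − (1/x) u_x + u_tt = x² u + 1` wherever `x > 0`. -/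
theorem grad_shafranov_Shi_Chi_invariant_solution (C₁ C₂ : ℝ) :
    ∀ p : ℝ × ℝ, 0 < p.1 →
      GS (fun q => Real.cosh (q.1 ^ 2 / 2) * (C₁ - (1 / 2) * Shi (q.1 ^ 2 / 2))
          + Real.sinh (q.1 ^ 2 / 2) * (C₂ + (1 / 2) * Chi (q.1 ^ 2 / 2))) p
        = p.1 ^ 2 * (Real.cosh (p.1 ^ 2 / 2) * (C₁ - (1 / 2) * Shi (p.1 ^ 2 / 2))
          + Real.sinh (p.1 ^ 2 / 2) * (C₂ + (1 / 2) * Chi (p.1 ^ 2 / 2))) + 1 := by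
  intro p hp
  have hw : ∀ y : ℝ, 0 < y → HasDerivAt (fun y => Real.cosh y * (C₁ - (1 / 2) * Shi y)
      + Real.sinh y * (C₂ + (1 / 2) * Chi y))
      (Real.sinh y * (C₁ - (1 / 2) * Shi y) + Real.cosh y * (C₂ + (1 / 2) * Chi y)) y := by
    intro y hy
    have h := ((Real.hasDerivAt_cosh y).mul (((aux_Shi y hy).const_mul (1 / 2)).const_sub C₁)).add
      ((Real.hasDerivAt_sinh y).mul (((aux_Chi y hy).const_mul (1 / 2)).const_add C₂))
    refine h.congr_deriv ?_
    ring
  have hw2 : ∀ y : ℝ, 0 < y → HasDerivAt (fun y => Real.sinh y * (C₁ - (1 / 2) * Shi y)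
      + Real.cosh y * (C₂ + (1 / 2) * Chi y))
      (Real.cosh y * (C₁ - (1 / 2) * Shi y) + Real.sinh y * (C₂ + (1 / 2) * Chi y)
        + 1 / (2 * y)) y := by
    intro y hy
    have h := ((Real.hasDerivAt_sinh y).mul (((aux_Shi y hy).const_mul (1 / 2)).const_sub C₁)).add
      ((Real.hasDerivAt_cosh y).mul (((aux_Chi y hy).const_mul (1 / 2)).const_add C₂))
    refine h.congr_deriv ?_
    have hcs := Real.cosh_sq y
    field_simp
    linear_combination hcs
  have hpos : ∀ x : ℝ, 0 < x → 0 < x ^ 2 / 2 := fun x hx => by positivity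
  have hev : ∀ᶠ q : ℝ × ℝ in nhds p, 0 < q.1 :=
    continuous_fst.continuousAt.eventually (lt_mem_nhds hp)
  set u : ℝ × ℝ → ℝ := fun q => Real.cosh (q.1 ^ 2 / 2) * (C₁ - (1 / 2) * Shi (q.1 ^ 2 / 2))
          + Real.sinh (q.1 ^ 2 / 2) * (C₂ + (1 / 2) * Chi (q.1 ^ 2 / 2)) with hu
  have h1 : ∀ q : ℝ × ℝ, 0 < q.1 → _ := fun q hq =>
    aux_px _ _ u q (Filter.EventuallyEq.refl _ _)
      ((hw (q.1 ^ 2 / 2) (hpos _ hq)).comp q.1 (aux_sq q.1))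
  have h2 := aux_px _ _ (px u) p (hev.mono fun q hq => (h1 q hq).1)
    (((hw2 (p.1 ^ 2 / 2) (hpos _ hp)).comp p.1 (aux_sq p.1)).mul (hasDerivAt_id p.1))
  have h3 := aux_px (fun _ => 0) 0 (pt u) p (hev.mono fun q hq => (h1 q hq).2)
    (hasDerivAt_const _ _)
  have hp' := hp.ne'
  rw [GS, h2.1, h3.2, (h1 p hp).1]
  simp only [Function.comp, id]
  field_simp
  ring
end

section
/- Let Ω ⊆ {(x,t) ∈ ℝ² : x > 0} be open and let u : ℝ² → ℝ be C² on Ω and satisfy u_xx − (1/x)·u_x + u_tt = x²·e^{2u} + e^{u} on Ω. Then for every s ∈ ℝ, the function v(x,t) = u(e^{−s}·x, e^{−s}·t) − 2s satisfies v_xx − (1/x)·v_x + v_tt = x²·e^{2v} + e^{v} at every point (x,t) with x > 0 and (e^{−s}x, e^{−s}t) ∈ Ω. -/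
/-- Directional derivatives of a rescaled function. -/
theorem fderiv_rescale (f : ℝ × ℝ → ℝ) (c k d : ℝ) (q e : ℝ × ℝ) :
    fderiv ℝ (fun q : ℝ × ℝ => k * f (c * q.1, c * q.2) - d) q e
      = k * (c * fderiv ℝ f (c * q.1, c * q.2) e) := by
  have h : (fun q : ℝ × ℝ => k * f (c * q.1, c * q.2) - d)
      = fun q => (k • fun q : ℝ × ℝ => f (c • q)) q - d := by
    funext q
    rfl
  rw [h, fderiv_sub_const, fderiv_const_smul_field, Pi.smul_apply, fderiv_comp_smul]
  rfl

/-- The symmetry `X = x ∂_x + t ∂_t − 2 ∂_u` of the equation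
`u_xx − (1/x) u_x + u_tt = x² e^{2u} + e^{u}` (equation (1) of the paper with
`a = −1`, `p = 2`, `F(u) = e^{2u}`, `G(u) = e^{u}`): if `u` solves the equation on
`Ω`, then for every `s ∈ ℝ` the function `v(x,t) = u(e^{−s} x, e^{−s} t) − 2s`
also solves it. -/
theorem grad_shafranov_exp_case_symmetry
    (Ω : Set (ℝ × ℝ)) (hΩ : IsOpen Ω) (hΩx : Ω ⊆ {p : ℝ × ℝ | 0 < p.1})
    (u : ℝ × ℝ → ℝ) (hu : ContDiffOn ℝ 2 u Ω)
    (hsol : ∀ p ∈ Ω, GS u p = p.1 ^ 2 * Real.exp (2 * u p) + Real.exp (u p)) (s : ℝ) :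
    ∀ p : ℝ × ℝ, 0 < p.1 → (Real.exp (-s) * p.1, Real.exp (-s) * p.2) ∈ Ω →
      GS (fun q => u (Real.exp (-s) * q.1, Real.exp (-s) * q.2) - 2 * s) p
        = p.1 ^ 2 * Real.exp (2 * (u (Real.exp (-s) * p.1, Real.exp (-s) * p.2) - 2 * s))
          + Real.exp (u (Real.exp (-s) * p.1, Real.exp (-s) * p.2) - 2 * s) := by
  intro p hp hpΩ
  have key := hsol _ hpΩ
  have hc : Real.exp (-s) ≠ 0 := (Real.exp_pos _).ne'
  have e2 : Real.exp (-(2 * s)) = Real.exp (-s) ^ 2 := by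
    rw [← Real.exp_nat_mul]; congr 1; push_cast; ring
  have e4 : Real.exp (-(4 * s)) = Real.exp (-s) ^ 4 := by
    rw [← Real.exp_nat_mul]; congr 1; push_cast; ring
  have r1 : ∀ w : ℝ, Real.exp (2 * (w - 2 * s)) = Real.exp (2 * w) * Real.exp (-s) ^ 4 := by
    intro w; rw [← e4, ← Real.exp_add]; congr 1; ring
  have r2 : ∀ w : ℝ, Real.exp (w - 2 * s) = Real.exp w * Real.exp (-s) ^ 2 := by
    intro w; rw [← e2, ← Real.exp_add]; congr 1
  rw [r1, r2]
  generalize Real.exp (-s) = c at *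
  have d1 : ∀ e : ℝ × ℝ, (fun q => fderiv ℝ (fun q : ℝ × ℝ => u (c * q.1, c * q.2) - 2 * s) q e)
      = fun q => c * (fun q => fderiv ℝ u q e) (c * q.1, c * q.2) - 0 := by
    intro e
    funext q
    have := fderiv_rescale u c 1 (2 * s) q e
    simpa using this
  have d2 : ∀ e : ℝ × ℝ,
      fderiv ℝ (fun q => fderiv ℝ (fun q : ℝ × ℝ => u (c * q.1, c * q.2) - 2 * s) q e) p e
      = c * (c * fderiv ℝ (fun q => fderiv ℝ u q e) (c * p.1, c * p.2) e) := by
    intro e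
    rw [d1 e]
    exact fderiv_rescale (fun q => fderiv ℝ u q e) c c 0 p e
  have d0 := congrFun (d1 (1, 0)) p
  have x1 := d2 (1, 0)
  have x2 := d2 (0, 1)
  simp only [GS] at key ⊢
  change fderiv ℝ (fun q => fderiv ℝ u q (1, 0)) (c * p.1, c * p.2) (1, 0)
    - 1 / (c * p.1) * fderiv ℝ u (c * p.1, c * p.2) (1, 0)
    + fderiv ℝ (fun q => fderiv ℝ u q (0, 1)) (c * p.1, c * p.2) (0, 1) = _ at key
  change fderiv ℝ (fun q => fderiv ℝ (fun q : ℝ × ℝ => u (c * q.1, c * q.2) - 2 * s) q (1, 0)) p (1, 0)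
    - 1 / p.1 * fderiv ℝ (fun q : ℝ × ℝ => u (c * q.1, c * q.2) - 2 * s) p (1, 0)
    + fderiv ℝ (fun q => fderiv ℝ (fun q : ℝ × ℝ => u (c * q.1, c * q.2) - 2 * s) q (0, 1)) p (0, 1) = _
  rw [x1, x2]
  dsimp only at d0
  rw [d0]
  have hp' := hp.ne'
  have hq : 1 / p.1 = c * (1 / (c * p.1)) := by field_simp
  rw [hq]
  linear_combination c ^ 2 * key
end

section
/- Let q be a nonzero real number, let Ω ⊆ {(x,t) ∈ ℝ² : x > 0} be open, and let u : ℝ² → ℝ be C² on Ω with u > 0 on Ω and satisfy u_xx − (1/x)·u_x + u_tt = x²·u^{1+2/q} + u^{1+1/q} on Ω. Then for every s ∈ ℝ, the function v(x,t) = e^{−2qs}·u(e^{−s}·x, e^{−s}·t) satisfies v_xx − (1/x)·v_x + v_tt = x²·v^{1+2/q} + v^{1+1/q} at every point (x,t) with x > 0 and (e^{−s}x, e^{−s}t) ∈ Ω. -/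
theorem fderiv_scale_aux (c l : ℝ) (u : ℝ × ℝ → ℝ) (p w : ℝ × ℝ) :
    fderiv ℝ (fun r : ℝ × ℝ => c * u (l * r.1, l * r.2)) p w
      = (c * l) * fderiv ℝ u (l * p.1, l * p.2) w := by
  have h : (fun r : ℝ × ℝ => c * u (l * r.1, l * r.2)) = c • (fun r : ℝ × ℝ => u (l • r)) := by
    funext r; rfl
  have e : ((l * p.1, l * p.2) : ℝ × ℝ) = l • p := rfl
  rw [h, fderiv_const_smul_field, Pi.smul_apply, fderiv_comp_smul, e]
  simp [mul_assoc]

theorem px_scale_aux (c l : ℝ) (u : ℝ × ℝ → ℝ) :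
    px (fun r : ℝ × ℝ => c * u (l * r.1, l * r.2))
      = fun r => (c * l) * px u (l * r.1, l * r.2) := by
  funext p; exact fderiv_scale_aux c l u p _

theorem pt_scale_aux (c l : ℝ) (u : ℝ × ℝ → ℝ) :
    pt (fun r : ℝ × ℝ => c * u (l * r.1, l * r.2))
      = fun r => (c * l) * pt u (l * r.1, l * r.2) := by
  funext p; exact fderiv_scale_aux c l u p _

/-- The symmetry `X = x ∂_x + t ∂_t − 2q u ∂_u` of the equation
`u_xx − (1/x) u_x + u_tt = x² u^{1+2/q} + u^{1+1/q}` (equation (1) of the paper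
with `a = −1`, `p = 2`, `F(u) = u^{1+2/q}`, `G(u) = u^{1+1/q}`, `q ≠ 0`): if `u > 0`
solves the equation on `Ω`, then for every `s ∈ ℝ` the function
`v(x,t) = e^{−2qs} u(e^{−s} x, e^{−s} t)` also solves it. -/
theorem grad_shafranov_power_case_symmetry
    (q : ℝ) (hq : q ≠ 0)
    (Ω : Set (ℝ × ℝ)) (hΩ : IsOpen Ω) (hΩx : Ω ⊆ {p : ℝ × ℝ | 0 < p.1})
    (u : ℝ × ℝ → ℝ) (hu : ContDiffOn ℝ 2 u Ω) (hupos : ∀ p ∈ Ω, 0 < u p)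
    (hsol : ∀ p ∈ Ω,
      GS u p = p.1 ^ 2 * u p ^ ((1 : ℝ) + 2 / q) + u p ^ ((1 : ℝ) + 1 / q)) (s : ℝ) :
    ∀ p : ℝ × ℝ, 0 < p.1 → (Real.exp (-s) * p.1, Real.exp (-s) * p.2) ∈ Ω →
      GS (fun r => Real.exp (-2 * q * s) * u (Real.exp (-s) * r.1, Real.exp (-s) * r.2)) p
        = p.1 ^ 2 * (Real.exp (-2 * q * s)
              * u (Real.exp (-s) * p.1, Real.exp (-s) * p.2)) ^ ((1 : ℝ) + 2 / q)
          + (Real.exp (-2 * q * s)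
              * u (Real.exp (-s) * p.1, Real.exp (-s) * p.2)) ^ ((1 : ℝ) + 1 / q) := by
  intro p hp hm
  have hs := hsol _ hm
  have hu0 := hupos _ hm
  have hl := Real.exp_pos (-s)
  have e1 : Real.exp (-2 * q * s) ^ ((1 : ℝ) + 2 / q)
      = Real.exp (-2 * q * s) * Real.exp (-s) ^ 4 := by
    rw [← Real.exp_mul, ← Real.exp_nat_mul, ← Real.exp_add]
    congr 1
    push_cast
    field_simp
    ring
  have e2 : Real.exp (-2 * q * s) ^ ((1 : ℝ) + 1 / q)
      = Real.exp (-2 * q * s) * Real.exp (-s) ^ 2 := by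
    rw [← Real.exp_mul, ← Real.exp_nat_mul, ← Real.exp_add]
    congr 1
    push_cast
    field_simp
    ring
  rw [Real.mul_rpow (Real.exp_pos _).le hu0.le, Real.mul_rpow (Real.exp_pos _).le hu0.le, e1, e2]
  unfold GS at hs ⊢
  simp only [px_scale_aux, pt_scale_aux] at hs ⊢
  generalize Real.exp (-2 * q * s) = c at *
  generalize Real.exp (-s) = l at *
  have hx : 1 / p.1 = l * (1 / (l * p.1)) := by field_simp
  rw [hx]
  linear_combination (c * l ^ 2) * hs
end
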